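/- Let X be a hypersurface of degree d and dimension n in P^{n+1} over F_q with 0 < k_X ≤ n, and suppose N_q(X) = Θ_{n,k_X}^{d,q}. If p is a singular F_q-point of X, then p belongs to every F_q-linear subspace of dimension k_X contained in X. -/

import Mathlib

/-- `NP q N` is the number of `F_q`-points of `P^N`, i.e. `q^N + q^(N-1) + … + q + 1`. -/
def NP (q N : ℕ) : ℕ := ∑ i ∈ Finset.range (N + 1), q ^ i

/-- `Theta q d n k` is the quantity `Θ_{n,k}^{d,q} = (d-1)·q^k·N_q(P^{n-k}) + N_q(P^k)`. -/
def Theta (q d n k : ℕ) : ℕ := (d - 1) * q ^ k * NP q (n - k) + NP q k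

/-- The number of `F`-rational points of the hypersurface `f = 0` in `P^{m-1}`. -/
noncomputable def numPoints {F : Type*} [Field F] {m : ℕ}
    (f : MvPolynomial (Fin m) F) : ℕ :=
  Nat.card {p : Projectivization F (Fin m → F) // MvPolynomial.eval p.rep f = 0}

/-- The projective linear subspace `P(W)` is contained in the hypersurface `f = 0`. -/
def SubInX {F : Type*} [Field F] {m : ℕ}
    (f : MvPolynomial (Fin m) F) (W : Submodule F (Fin m → F)) : Prop :=
  ∀ v ∈ W, MvPolynomial.eval v f = 0

/-- The Thas invariant of the hypersurface `f = 0` equals `k`: there is an `F`-linear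
projective subspace of dimension `k` contained in it, and none of dimension `k + 1`. -/
def ThasEq {F : Type*} [Field F] {m : ℕ}
    (f : MvPolynomial (Fin m) F) (k : ℕ) : Prop :=
  (∃ W : Submodule F (Fin m → F), Module.finrank F W = k + 1 ∧ SubInX f W) ∧
  ¬ ∃ W : Submodule F (Fin m → F), Module.finrank F W = k + 2 ∧ SubInX f W

/-- `v` is a homogeneous coordinate vector of a singular `F`-point of `f = 0`. -/
def IsSingPt {F : Type*} [Field F] {m : ℕ}
    (f : MvPolynomial (Fin m) F) (v : Fin m → F) : Prop :=
  v ≠ 0 ∧ MvPolynomial.eval v f = 0 ∧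
    ∀ i, MvPolynomial.eval v (MvPolynomial.pderiv i f) = 0

/-- The restriction of `f` to the parametrized affine line `t ↦ a + t • u`. -/
noncomputable def lineRestrict {F σ : Type*} [Field F] (f : MvPolynomial σ F) (a u : σ → F) :
    Polynomial F :=
  MvPolynomial.aeval (fun i => Polynomial.C (a i) + Polynomial.C (u i) * Polynomial.X) f

section LineRestrict

variable {F σ : Type*} [Field F]

theorem eval_lineRestrict (f : MvPolynomial σ F) (a u : σ → F) (t : F) :
    (lineRestrict f a u).eval t = MvPolynomial.eval (a + t • u) f := by
  unfold lineRestrict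
  induction f using MvPolynomial.induction_on with
  | C c => simp
  | add p q hp hq => simp only [map_add, Polynomial.eval_add, hp, hq]
  | mul_X p i hp =>
    simp only [map_mul, Polynomial.eval_mul, hp, MvPolynomial.aeval_X, MvPolynomial.eval_X]
    simp only [Polynomial.eval_add, Polynomial.eval_mul, Polynomial.eval_C, Polynomial.eval_X,
      Pi.add_apply, Pi.smul_apply, smul_eq_mul]
    ring

theorem eval_zero_derivative_lineRestrict [Fintype σ] (f : MvPolynomial σ F) (a u : σ → F) :
    (Polynomial.derivative (lineRestrict f a u)).eval 0 =
      ∑ i, u i * MvPolynomial.eval a (MvPolynomial.pderiv i f) := by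
  classical
  induction f using MvPolynomial.induction_on with
  | C c => simp [lineRestrict]
  | add p q hp hq =>
    have h : lineRestrict (p + q) a u = lineRestrict p a u + lineRestrict q a u := by
      simp [lineRestrict]
    rw [h]
    simp only [map_add, Polynomial.eval_add, hp, hq, mul_add, Finset.sum_add_distrib]
  | mul_X p j hp =>
    have h : lineRestrict (p * MvPolynomial.X j) a u = lineRestrict p a u *
        (Polynomial.C (a j) + Polynomial.C (u j) * Polynomial.X) := by
      simp [lineRestrict]
    rw [h, Polynomial.derivative_mul, Polynomial.eval_add, Polynomial.eval_mul, hp,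
      Polynomial.eval_mul, eval_lineRestrict]
    simp only [MvPolynomial.pderiv_mul, MvPolynomial.pderiv_X, map_add, map_mul,
      MvPolynomial.eval_X, mul_add, Finset.sum_add_distrib, Finset.sum_mul, mul_assoc]
    simp only [Pi.single_apply, apply_ite (MvPolynomial.eval a), map_one, map_zero, mul_ite,
      mul_one, mul_zero, Finset.sum_ite_eq, Finset.mem_univ, if_true]
    have hval : (Polynomial.C (a j) + Polynomial.C (u j) * Polynomial.X).eval 0 = a j := by simp
    have hder : (Polynomial.derivative (Polynomial.C (a j)) +
        Polynomial.derivative (Polynomial.C (u j) * Polynomial.X)).eval 0 = u j := by simp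
    rw [hval, hder, zero_smul, add_zero, mul_comm (u j)]

theorem natDegree_lineRestrict_le {f : MvPolynomial σ F} {D : ℕ} (hf : f.totalDegree ≤ D)
    (a u : σ → F) : (lineRestrict f a u).natDegree ≤ D := by
  have h := MvPolynomial.aeval_natDegree_le (n := 1) f hf
    (fun i => Polynomial.C (a i) + Polynomial.C (u i) * Polynomial.X)
    (fun i => by rw [add_comm]; exact Polynomial.natDegree_linear_le)
  rwa [mul_one] at h

theorem coeff_prod_linear_pow (a u : σ → F) (s : σ → ℕ) (S : Finset σ) :
    (∏ i ∈ S, (Polynomial.C (a i) + Polynomial.C (u i) * Polynomial.X) ^ s i).natDegree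
        ≤ ∑ i ∈ S, s i ∧
      (∏ i ∈ S, (Polynomial.C (a i) + Polynomial.C (u i) * Polynomial.X) ^ s i).coeff
        (∑ i ∈ S, s i) = ∏ i ∈ S, u i ^ s i := by
  classical
  have hlin (i : σ) :
      (Polynomial.C (a i) + Polynomial.C (u i) * Polynomial.X).natDegree ≤ 1 := by
    rw [add_comm]; exact Polynomial.natDegree_linear_le
  have hpow (i : σ) :
      ((Polynomial.C (a i) + Polynomial.C (u i) * Polynomial.X) ^ s i).natDegree ≤ s i :=
    Polynomial.natDegree_pow_le.trans (by simpa using Nat.mul_le_mul_left (s i) (hlin i))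
  induction S using Finset.induction_on with
  | empty => simp
  | insert j S hj ih =>
    rw [Finset.prod_insert hj, Finset.sum_insert hj, Finset.prod_insert hj]
    refine ⟨Polynomial.natDegree_mul_le.trans (add_le_add (hpow j) ih.1), ?_⟩
    rw [Polynomial.coeff_mul_add_eq_of_natDegree_le (hpow j) ih.1, ih.2]
    congr 1
    have h := Polynomial.coeff_pow_of_natDegree_le (m := s j) (hlin j)
    simpa using h

theorem coeff_lineRestrict {f : MvPolynomial σ F} {D : ℕ} (hf : f.totalDegree ≤ D)
    (a u : σ → F) : (lineRestrict f a u).coeff D =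
      MvPolynomial.eval u (MvPolynomial.homogeneousComponent D f) := by
  classical
  rw [MvPolynomial.homogeneousComponent_apply, map_sum, Finset.sum_filter, lineRestrict,
    MvPolynomial.aeval_def, MvPolynomial.eval₂_eq, Polynomial.finsetSum_coeff]
  refine Finset.sum_congr rfl fun s hs => ?_
  have hsD : s.degree ≤ D := (MvPolynomial.le_totalDegree hs).trans hf
  have h := coeff_prod_linear_pow a u s s.support
  change _ ≤ s.degree ∧ Polynomial.coeff _ s.degree = _ at h
  rw [← Polynomial.C_eq_algebraMap, Polynomial.coeff_C_mul]
  split_ifs with hd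
  · subst hd
    rw [h.2, MvPolynomial.eval_monomial, Finsupp.prod]
  · rw [Polynomial.coeff_eq_zero_of_natDegree_lt (h.1.trans_lt (lt_of_le_of_ne hsD hd)), mul_zero]

theorem totalDegree_aeval_le {τ : Type*} (f : MvPolynomial σ F) (g : σ → MvPolynomial τ F)
    (hg : ∀ i, (g i).totalDegree ≤ 1) :
    (MvPolynomial.aeval g f).totalDegree ≤ f.totalDegree := by
  rw [MvPolynomial.aeval_def, MvPolynomial.eval₂_eq]
  refine MvPolynomial.totalDegree_finsetSum_le fun s hs => ?_
  refine (MvPolynomial.totalDegree_mul _ _).trans ?_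
  rw [MvPolynomial.algebraMap_eq, MvPolynomial.totalDegree_C, zero_add]
  refine (MvPolynomial.totalDegree_finsetProd _ _).trans ?_
  refine le_trans (Finset.sum_le_sum fun i _ => ?_) (MvPolynomial.le_totalDegree hs)
  exact (MvPolynomial.totalDegree_pow _ _).trans
    (by simpa using Nat.mul_le_mul_left (s i) (hg i))

/-- If `f` has degree at most `|F|` and does not vanish identically on the affine subspace `v + W`,
then for some direction in `W` the restriction of `f` to every line of `v + W` in that direction is
a nonzero polynomial. -/
theorem exists_lineRestrict_ne_zero [Finite σ] [Fintype F] {f : MvPolynomial σ F}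
    (hf : f.totalDegree ≤ Fintype.card F) (W : Submodule F (σ → F)) (v : σ → F)
    (hv : ∃ w ∈ W, MvPolynomial.eval (v + w) f ≠ 0) :
    ∃ u ∈ W, ∀ w ∈ W, lineRestrict f (v + w) u ≠ 0 := by
  let b := Module.finBasis F W
  let L : (Fin (Module.finrank F W) → F) → σ → F := fun x => ∑ i, x i • (b i : σ → F)
  have hL (x) : L x ∈ W := W.sum_mem fun i _ => W.smul_mem _ (b i).2
  have hsurj (w) (hw : w ∈ W) : ∃ x, L x = w := by
    refine ⟨b.repr ⟨w, hw⟩, ?_⟩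
    have h := congrArg (Subtype.val : W → σ → F) (b.sum_repr ⟨w, hw⟩)
    simpa only [L, Submodule.coe_sum, Submodule.coe_smul] using h
  let g : σ → MvPolynomial (Fin (Module.finrank F W)) F := fun j =>
    MvPolynomial.C (v j) + ∑ i, MvPolynomial.C ((b i : σ → F) j) * MvPolynomial.X i
  have hg (j) : (g j).totalDegree ≤ 1 := by
    refine (MvPolynomial.totalDegree_add _ _).trans (max_le (by simp) ?_)
    refine MvPolynomial.totalDegree_finsetSum_le fun i _ => ?_
    refine (MvPolynomial.totalDegree_mul _ _).trans ?_
    simp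
  let G := MvPolynomial.aeval g f
  have hline (x y) : lineRestrict G x y = lineRestrict f (v + L x) (L y) := by
    simp only [lineRestrict, G]
    rw [← AlgHom.comp_apply, MvPolynomial.comp_aeval]
    congr 2
    funext j
    simp only [g, L, map_add, map_sum, map_mul, MvPolynomial.algHom_C, MvPolynomial.aeval_X,
      Polynomial.algebraMap_eq, mul_add, Finset.sum_add_distrib, Finset.mul_sum, add_assoc,
      Pi.add_apply, Finset.sum_apply, Pi.smul_apply, smul_eq_mul, mul_comm, mul_left_comm]
  have hG : G ≠ 0 := by
    intro h0
    obtain ⟨w, hw, hne⟩ := hv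
    obtain ⟨x, rfl⟩ := hsurj w hw
    apply hne
    have h := congrArg (Polynomial.eval 0) (hline x 0)
    rw [h0, eval_lineRestrict, eval_lineRestrict] at h
    simpa using h.symm
  have htop : MvPolynomial.homogeneousComponent G.totalDegree G ≠ 0 := by
    obtain ⟨s, hs, hdeg⟩ := Finset.exists_mem_eq_sup G.support
      (MvPolynomial.support_nonempty.mpr hG) fun s => s.sum fun _ e => e
    intro h0
    have h := MvPolynomial.coeff_homogeneousComponent G.totalDegree G s
    rw [h0, MvPolynomial.coeff_zero, if_pos (by exact hdeg.symm)] at h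
    exact MvPolynomial.mem_support_iff.mp hs h.symm
  have hle : G.totalDegree ≤ Fintype.card F := (totalDegree_aeval_le f g hg).trans hf
  obtain ⟨y, hy⟩ : ∃ y, MvPolynomial.eval y
      (MvPolynomial.homogeneousComponent G.totalDegree G) ≠ 0 := by
    by_contra! h
    have hhom := MvPolynomial.homogeneousComponent_isHomogeneous G.totalDegree G
    exact htop (hhom.eq_zero_of_forall_eval_eq_zero_of_le_card h (by simpa using hle))
  refine ⟨L y, hL y, fun w hw h0 => hy ?_⟩
  obtain ⟨x, rfl⟩ := hsurj w hw
  rw [← coeff_lineRestrict le_rfl x y, hline, h0, Polynomial.coeff_zero]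

end LineRestrict

section Counting

variable {F : Type*} [Field F] [Fintype F] [DecidableEq F]

theorem card_filter_eval_eq_zero_le {P : Polynomial F} (hP : P ≠ 0) :
    (Finset.univ.filter fun t => P.eval t = 0).card ≤ P.natDegree := by
  refine Polynomial.card_le_degree_of_subset_roots fun t ht => ?_
  simpa [hP] using ht

theorem card_filter_eval_eq_zero_lt {P : Polynomial F} (hP : P ≠ 0) {a : F}
    (ha : P.eval a = 0) (ha' : (Polynomial.derivative P).eval a = 0) :
    (Finset.univ.filter fun t => P.eval t = 0).card < P.natDegree := by
  have hmult : 1 < P.roots.count a := by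
    rw [Polynomial.count_roots]
    exact (Polynomial.one_lt_rootMultiplicity_iff_isRoot hP).mpr ⟨ha, ha'⟩
  have hmem : a ∈ P.roots := Multiset.count_pos.mp (zero_lt_one.trans hmult)
  have hsub : (Finset.univ.filter fun t => P.eval t = 0).val ⊆ P.roots.erase a := by
    intro t ht
    by_cases hta : t = a
    · subst hta
      rw [← Multiset.count_pos, Multiset.count_erase_self]
      omega
    · rw [Multiset.mem_erase_of_ne hta]
      simpa [hP] using ht
  have hle := Multiset.card_le_card
    ((Multiset.le_iff_subset (Finset.univ.filter fun t => P.eval t = 0).nodup).mpr hsub)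
  rw [Finset.card_val] at hle
  exact (hle.trans_lt (Multiset.card_erase_lt_of_mem hmem)).trans_le (Polynomial.card_roots' P)

variable {σ : Type*} [Fintype σ]

omit [Fintype σ] in
theorem card_mul_card_zeros (f : MvPolynomial σ F) (W : Submodule F (σ → F)) [Fintype W]
    (v : σ → F) {u : σ → F} (hu : u ∈ W) :
    Fintype.card F * (Finset.univ.filter fun w : W => MvPolynomial.eval (v + w.1) f = 0).card =
      ∑ w : W, (Finset.univ.filter fun t => (lineRestrict f (v + w) u).eval t = 0).card := by
  simp only [Finset.card_filter, eval_lineRestrict]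
  rw [Finset.sum_comm, ← Finset.card_univ, ← smul_eq_mul, ← Finset.sum_const]
  refine Finset.sum_congr rfl fun t _ => ?_
  refine (Fintype.sum_equiv (Equiv.addRight (t • (⟨u, hu⟩ : W))) _ _ fun w => ?_).symm
  change _ = if MvPolynomial.eval (v + (w.1 + t • u)) f = 0 then 1 else 0
  rw [add_assoc]

section Homogeneous

variable {f : MvPolynomial σ F} {d : ℕ} (hhom : f.IsHomogeneous d) {W : Submodule F (σ → F)}
  [Fintype W] {v : σ → F}

omit [Fintype F] [DecidableEq F] [Fintype σ] in
include hhom in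
theorem natDegree_lineRestrict_lt (hd : 0 < d) {u : σ → F} (hu : MvPolynomial.eval u f = 0) :
    (lineRestrict f v u).natDegree < d := by
  have hle := natDegree_lineRestrict_le hhom.totalDegree_le v u
  refine lt_of_le_of_ne hle fun h => ?_
  have hc := coeff_lineRestrict hhom.totalDegree_le v u
  rw [MvPolynomial.homogeneousComponent_of_mem
    ((MvPolynomial.mem_homogeneousSubmodule d f).mpr hhom), if_pos rfl, hu, ← h,
    Polynomial.coeff_natDegree, Polynomial.leadingCoeff_eq_zero] at hc
  rw [hc, Polynomial.natDegree_zero] at h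
  omega

omit [Fintype σ] in
theorem card_mul_card_zeros_lt_of_card_lt (hd : Fintype.card F < d)
    (hv : ∃ w ∈ W, MvPolynomial.eval (v + w) f ≠ 0) :
    Fintype.card F * (Finset.univ.filter fun w : W => MvPolynomial.eval (v + w.1) f = 0).card <
      (d - 1) * Fintype.card W := by
  obtain ⟨w, hw, hne⟩ := hv
  have hlt : (Finset.univ.filter fun w : W => MvPolynomial.eval (v + w.1) f = 0).card <
      Fintype.card W :=
    Finset.card_lt_card (Finset.filter_ssubset.mpr ⟨⟨w, hw⟩, Finset.mem_univ _, hne⟩)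
  exact (Nat.mul_lt_mul_of_pos_left hlt Fintype.card_pos).trans_le
    (Nat.mul_le_mul_right _ (by omega))

include hhom in
theorem card_mul_card_zeros_le (hd : 0 < d) (hW : ∀ w ∈ W, MvPolynomial.eval w f = 0)
    (hv : ∃ w ∈ W, MvPolynomial.eval (v + w) f ≠ 0) :
    Fintype.card F * (Finset.univ.filter fun w : W => MvPolynomial.eval (v + w.1) f = 0).card ≤
      (d - 1) * Fintype.card W := by
  rcases lt_or_ge (Fintype.card F) d with hq | hq
  · exact (card_mul_card_zeros_lt_of_card_lt hq hv).le
  obtain ⟨u, hu, hne⟩ := exists_lineRestrict_ne_zero (hhom.totalDegree_le.trans hq) W v hv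
  rw [card_mul_card_zeros f W v hu, mul_comm, ← Finset.card_univ, ← smul_eq_mul]
  refine Finset.sum_le_card_nsmul _ _ _ fun w _ => ?_
  have h1 := card_filter_eval_eq_zero_le (hne w w.2)
  have h2 := natDegree_lineRestrict_lt (v := v + w) hhom hd (hW u hu)
  omega

include hhom in
theorem card_mul_card_zeros_lt (hd : 0 < d) (hW : ∀ w ∈ W, MvPolynomial.eval w f = 0)
    (hv : ∃ w ∈ W, MvPolynomial.eval (v + w) f ≠ 0) (hv0 : MvPolynomial.eval v f = 0)
    (hsing : ∀ i, MvPolynomial.eval v (MvPolynomial.pderiv i f) = 0) :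
    Fintype.card F * (Finset.univ.filter fun w : W => MvPolynomial.eval (v + w.1) f = 0).card <
      (d - 1) * Fintype.card W := by
  rcases lt_or_ge (Fintype.card F) d with hq | hq
  · exact card_mul_card_zeros_lt_of_card_lt hq hv
  obtain ⟨u, hu, hne⟩ := exists_lineRestrict_ne_zero (hhom.totalDegree_le.trans hq) W v hv
  have hdeg (w : W) := natDegree_lineRestrict_lt (v := v + w) hhom hd (hW u hu)
  rw [card_mul_card_zeros f W v hu, mul_comm, ← Finset.card_univ, ← smul_eq_mul,
    ← Finset.sum_const]
  refine Finset.sum_lt_sum (fun w _ => ?_) ⟨0, Finset.mem_univ _, ?_⟩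
  · have h1 := card_filter_eval_eq_zero_le (hne w w.2)
    have h2 := hdeg w
    omega
  · have h1 := card_filter_eval_eq_zero_lt (hne 0 W.zero_mem) (a := 0)
      (by simp [eval_lineRestrict, hv0])
      (by simp [eval_zero_derivative_lineRestrict, hsing])
    have h2 := hdeg 0
    rw [Submodule.coe_zero] at h2 ⊢
    omega

end Homogeneous

theorem sum_card_zeros_translate [DecidableEq σ] (f : MvPolynomial σ F) (W : Submodule F (σ → F)) [Fintype W] :
    ∑ v, (Finset.univ.filter fun w : W => MvPolynomial.eval (v + w.1) f = 0).card =
      Fintype.card W * (Finset.univ.filter fun v => MvPolynomial.eval v f = 0).card := by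
  simp only [Finset.card_filter]
  rw [Finset.sum_comm, ← Finset.card_univ, ← smul_eq_mul, ← Finset.sum_const]
  refine Finset.sum_congr rfl fun w _ => ?_
  exact Fintype.sum_equiv (Equiv.addRight (w : σ → F)) _ _ fun v => rfl

end Counting

theorem MvPolynomial.IsHomogeneous.eval_smul_eq {F σ : Type*} [Field F] {f : MvPolynomial σ F}
    {d : ℕ} (hf : f.IsHomogeneous d) (c : F) (x : σ → F) :
    MvPolynomial.eval (c • x) f = c ^ d * MvPolynomial.eval x f := by
  classical
  rw [MvPolynomial.eval_eq, MvPolynomial.eval_eq, Finset.mul_sum]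
  refine Finset.sum_congr rfl fun s hs => ?_
  have h : s.degree = d := by
    rw [Finsupp.degree_eq_weight_one]
    exact hf (MvPolynomial.mem_support_iff.mp hs)
  simp only [Pi.smul_apply, smul_eq_mul, mul_pow, Finset.prod_mul_distrib]
  rw [Finset.prod_pow_eq_pow_sum]
  change _ * (c ^ s.degree * _) = _
  rw [h]
  ring

theorem exists_eval_add_ne_zero {F : Type*} [Field F] {m d k : ℕ}
    {f : MvPolynomial (Fin m) F} (hf : f.IsHomogeneous d) (hthas : ThasEq f k)
    {W : Submodule F (Fin m → F)} (hrank : Module.finrank F W = k + 1) (hW : SubInX f W)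
    {v : Fin m → F} (hv : v ∉ W) : ∃ w ∈ W, MvPolynomial.eval (v + w) f ≠ 0 := by
  by_contra! h
  refine hthas.2 ⟨W ⊔ Submodule.span F {v}, ?_, ?_⟩
  · rw [Submodule.finrank_sup_span_singleton hv, hrank]
  · intro x hx
    obtain ⟨w, hw, y, hy, rfl⟩ := Submodule.mem_sup.mp hx
    obtain ⟨c, rfl⟩ := Submodule.mem_span_singleton.mp hy
    rcases eq_or_ne c 0 with rfl | hc
    · simpa using hW w hw
    · have hx : w + c • v = c • (v + c⁻¹ • w) := by
        rw [smul_add, smul_inv_smul₀ hc, add_comm]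
      rw [hx, hf.eval_smul_eq, h _ (W.smul_mem _ hw), mul_zero]

theorem NP_mul_sub_one (q N : ℕ) (hq : 0 < q) : NP q N * (q - 1) + 1 = q ^ (N + 1) := by
  rw [NP]
  zify [hq]
  rw [geom_sum_mul]
  ring

theorem card_zeros_eq_numPoints {F : Type*} [Field F] [Fintype F] [DecidableEq F] {m d : ℕ}
    {f : MvPolynomial (Fin m) F} (hd : 0 < d) (hf : f.IsHomogeneous d) :
    (Finset.univ.filter fun v => MvPolynomial.eval v f = 0).card =
      numPoints f * (Fintype.card F - 1) + 1 := by
  classical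
  have h0 : MvPolynomial.eval (0 : Fin m → F) f = 0 := by
    have h := hf.eval_smul_eq 0 0
    rwa [zero_pow hd.ne', zero_mul, zero_smul] at h
  let e : {p : Projectivization F (Fin m → F) // MvPolynomial.eval p.rep f = 0} × Fˣ →
      {v : Fin m → F // v ≠ 0 ∧ MvPolynomial.eval v f = 0} := fun x =>
    ⟨x.2.1 • x.1.1.rep, smul_ne_zero x.2.ne_zero x.1.1.rep_nonzero, by
      rw [hf.eval_smul_eq, x.1.2, mul_zero]⟩
  have he : Function.Bijective e := by
    constructor
    · rintro ⟨⟨p, hp⟩, c⟩ ⟨⟨p', hp'⟩, c'⟩ h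
      have h : c.1 • p.rep = c'.1 • p'.rep := congrArg Subtype.val h
      have hpp : p = p' := by
        rw [← p.mk_rep, ← p'.mk_rep, Projectivization.mk_eq_mk_iff]
        exact ⟨c⁻¹ * c', by rw [mul_smul, inv_smul_eq_iff]; exact h.symm⟩
      subst hpp
      have hcc : c = c' := Units.ext (smul_left_injective F p.rep_nonzero h)
      rw [hcc]
    · rintro ⟨v, hv, hfv⟩
      obtain ⟨c, hc⟩ := Projectivization.exists_smul_eq_mk_rep F v hv
      have hc : c.1 • v = (Projectivization.mk F v hv).rep := hc
      refine ⟨⟨⟨Projectivization.mk F v hv, ?_⟩, c⁻¹⟩, Subtype.ext ?_⟩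
      · rw [← hc, hf.eval_smul_eq, hfv, mul_zero]
      · change c⁻¹.1 • (Projectivization.mk F v hv).rep = v
        rw [← hc, smul_smul, Units.inv_mul, one_smul]
  have hcard := Nat.card_congr (Equiv.ofBijective e he)
  rw [Nat.card_prod, Nat.card_eq_fintype_card (α := Fˣ), Fintype.card_units,
    Nat.card_eq_fintype_card (α := {v : Fin m → F // v ≠ 0 ∧ MvPolynomial.eval v f = 0}),
    Fintype.card_subtype] at hcard
  change numPoints f * _ = _ at hcard
  rw [hcard, ← Finset.card_erase_add_one (a := (0 : Fin m → F)) (by simpa using h0)]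
  congr 2
  ext v
  simp

theorem stmt6 {F : Type*} [Field F] [Fintype F] {n d k : ℕ}
    (hn : 1 ≤ n) (hd : 2 ≤ d) (hk1 : 0 < k) (hkn : k ≤ n)
    (f : MvPolynomial (Fin (n + 2)) F) (hf0 : f ≠ 0) (hsq : Squarefree f)
    (hhom : f.IsHomogeneous d) (hthas : ThasEq f k)
    (heq : numPoints f = Theta (Fintype.card F) d n k) :
    ∀ v : Fin (n + 2) → F, IsSingPt f v →
      ∀ W : Submodule F (Fin (n + 2) → F),
        Module.finrank F W = k + 1 → SubInX f W → v ∈ W := by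
  let _ := Classical.decEq F
  intro v ⟨_, hv0, hsing⟩ W hrank hW
  let _ := Classical.decPred (· ∈ W)
  by_contra hv
  have hd0 : 0 < d := by omega
  have hne {x} (hx : x ∉ W) := exists_eval_add_ne_zero hhom hthas hrank hW hx
  let B : (Fin (n + 2) → F) → ℕ := fun x =>
    if x ∈ W then Fintype.card F * Fintype.card W else (d - 1) * Fintype.card W
  have hlt : ∑ x, Fintype.card F *
      (Finset.univ.filter fun w : W => MvPolynomial.eval (x + w.1) f = 0).card < ∑ x, B x := by
    refine Finset.sum_lt_sum (fun x _ => ?_) ⟨v, Finset.mem_univ v, ?_⟩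
    · by_cases hx : x ∈ W
      · simp only [B, if_pos hx]
        exact Nat.mul_le_mul_left _ (Finset.card_le_univ _)
      · simp only [B, if_neg hx]
        exact card_mul_card_zeros_le hhom hd0 hW (hne hx)
    · simp only [B, if_neg hv]
      exact card_mul_card_zeros_lt hhom hd0 hW (hne hv) hv0 hsing
  have hWcard : Fintype.card W = Fintype.card F ^ (k + 1) := by
    rw [Module.card_eq_pow_finrank (K := F), hrank]
  have hcompl : (Finset.univ.filter fun x => x ∉ W).card + Fintype.card W =
      Fintype.card F ^ (n + 2) := by
    have h := Finset.card_filter_add_card_filter_not (s := Finset.univ) fun x => x ∈ W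
    rw [← Fintype.card_subtype, Finset.card_univ, Fintype.card_fun, Fintype.card_fin] at h
    rw [add_comm]
    exact h
  rw [← Finset.mul_sum, sum_card_zeros_translate, card_zeros_eq_numPoints hd0 hhom, heq] at hlt
  simp only [B, Finset.sum_ite, Finset.sum_const, smul_eq_mul] at hlt
  rw [← Fintype.card_subtype] at hlt
  change _ < Fintype.card W * _ + _ at hlt
  have hq : 0 < Fintype.card F := Fintype.card_pos
  have hNP1 := NP_mul_sub_one (Fintype.card F) k hq
  have hNP2 := NP_mul_sub_one (Fintype.card F) (n - k) hq
  have hpow : Fintype.card F ^ (n + 2) =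
      Fintype.card F ^ (n - k + 1) * Fintype.card F ^ (k + 1) := by
    rw [← pow_add]
    congr 1
    omega
  rw [hpow, hWcard, ← hNP2] at hcompl
  rw [hWcard] at hlt
  have hc : (Finset.univ.filter fun x => x ∉ W).card =
      NP (Fintype.card F) (n - k) * (Fintype.card F - 1) * Fintype.card F ^ (k + 1) := by
    linarith
  have hTheta : Theta (Fintype.card F) d n k * (Fintype.card F - 1) + 1 =
      (d - 1) * Fintype.card F ^ k * NP (Fintype.card F) (n - k) * (Fintype.card F - 1) +
        Fintype.card F ^ (k + 1) := by
    rw [Theta, ← hNP1]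
    ring
  rw [hc, hTheta] at hlt
  exact hlt.ne (by ring)
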